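/- Let Γ₀, Γ₁, Γ₂ be groups with injective homomorphisms Γ₀ → Γ₁ and Γ₀ → Γ₂, let Γ = Γ₁ *_{Γ₀} Γ₂ be the amalgamated free product, assumed finitely generated, and let ρ : Γ → PSL(2,ℂ) be a homomorphism such that ρ(Γ₀) is abelian and not isomorphic to ℤ/2 × ℤ/2. Let Z⁰ be the connected component of the identity in the centralizer of ρ(Γ₀) in PSL(2,ℂ), and for S ∈ Z⁰ let ρ_S : Γ → PSL(2,ℂ) be the unique homomorphism with ρ_S(γ) = ρ(γ) for γ ∈ Γ₁ and ρ_S(γ) = S ρ(γ) S⁻¹ for γ ∈ Γ₂. Then tr²(ρ_S(γ)) = tr²(ρ(γ)) for all S ∈ Z⁰ and all γ ∈ Γ (i.e., the bending function S ↦ χ_{ρ_S} is constant) if and only if one of the following holds: (a) ρ(Γ₀) is trivial and at least one of ρ(Γ₁), ρ(Γ₂) is trivial; (b) ρ(Γ₀) is nontrivial and either ρ(Γ₁) is abelian and the restriction ρ|Γ₁ is reducible, or ρ(Γ₂) is abelian and the restriction ρ|Γ₂ is reducible, or ρ itself is reducible. -/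

import Mathlib

noncomputable section

/-- `SL(2,ℂ)`. -/
abbrev SL2C : Type := Matrix.SpecialLinearGroup (Fin 2) ℂ

/-- `PSL(2,ℂ)`, the quotient of `SL(2,ℂ)` by its center `{±I}`. -/
abbrev PSL2C : Type := SL2C ⧸ Subgroup.center SL2C

/-- The matrix topology on `SL(2,ℂ)`; `PSL(2,ℂ)` then carries the quotient topology. -/
instance : TopologicalSpace SL2C :=
  TopologicalSpace.induced (fun M => (M : Matrix (Fin 2) (Fin 2) ℂ)) inferInstance

/-- The canonical projection `SL(2,ℂ) → PSL(2,ℂ)`. -/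
def projPSL : SL2C →* PSL2C := QuotientGroup.mk' (Subgroup.center SL2C)

/-- Squared trace, well defined on `PSL(2,ℂ)`. -/
def tr2 (x : PSL2C) : ℂ :=
  (Matrix.trace ((Quotient.out x : SL2C) : Matrix (Fin 2) (Fin 2) ℂ)) ^ 2

/-- A homomorphism into `PSL(2,ℂ)` is reducible if some nonzero `v ∈ ℂ²` is an eigenvector of
every matrix representing an element of the image. -/
def IsReducibleRep {Γ : Type*} [Group Γ] (ρ : Γ →* PSL2C) : Prop :=
  ∃ v : Fin 2 → ℂ, v ≠ 0 ∧ ∀ (γ : Γ) (M : SL2C), projPSL M = ρ γ →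
    ∃ c : ℂ, Matrix.mulVec (M : Matrix (Fin 2) (Fin 2) ℂ) v = c • v

/-- `S` lies in the connected component of the identity of the centralizer of `E` in
`PSL(2,ℂ)`. -/
def MemIdCompCentralizer (E : Set PSL2C) (S : PSL2C) : Prop :=
  ∃ hS : S ∈ Subgroup.centralizer E,
    (⟨S, hS⟩ : ↥(Subgroup.centralizer E)) ∈
      connectedComponent (1 : ↥(Subgroup.centralizer E))

open Matrix

/-- the underlying matrix -/
def mx : SL2C →* Matrix (Fin 2) (Fin 2) ℂ where
  toFun M := (M : Matrix (Fin 2) (Fin 2) ℂ)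
  map_one' := rfl
  map_mul' _ _ := rfl

lemma mx_det (M : SL2C) : (mx M).det = 1 := M.2

lemma mx_inj {M N : SL2C} (h : mx M = mx N) : M = N := Subtype.ext h

lemma mx_inv_mul (M : SL2C) : mx M⁻¹ * mx M = 1 := by rw [← map_mul]; simp

lemma mx_mul_inv (M : SL2C) : mx M * mx M⁻¹ = 1 := by rw [← map_mul]; simp

lemma mx_inv (M : SL2C) : mx M⁻¹ = !![mx M 1 1, - mx M 0 1; - mx M 1 0, mx M 0 0] := by
  have : mx M⁻¹ = adjugate (mx M) := rfl
  rw [this, adjugate_fin_two]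

lemma sq_eq_one_x {r : ℂ} (h : r ^ 2 = 1) : r = 1 ∨ r = -1 := by
  have : (r - 1) * (r + 1) = 0 := by linear_combination h
  rcases mul_eq_zero.1 this with h | h
  · left; linear_combination h
  · right; linear_combination h

lemma proj_eq_iff (M N : SL2C) : projPSL M = projPSL N ↔ (mx N = mx M ∨ mx N = -mx M) := by
  unfold projPSL
  rw [QuotientGroup.mk'_eq_mk']
  constructor
  · rintro ⟨z, hz, rfl⟩
    rw [Matrix.SpecialLinearGroup.mem_center_iff] at hz
    obtain ⟨r, hr, hz⟩ := hz
    simp only [Fintype.card_fin] at hr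
    have hz : mx z = r • 1 := by
      change (z : Matrix (Fin 2) (Fin 2) ℂ) = _
      rw [← hz, scalar_apply, Matrix.smul_one_eq_diagonal]
    have : r = 1 ∨ r = -1 := sq_eq_one_x hr
    rw [map_mul, hz]
    rcases this with rfl | rfl <;> simp
  · intro h
    refine ⟨M⁻¹ * N, ?_, by group⟩
    rw [Subgroup.mem_center_iff]
    intro g
    apply mx_inj
    simp only [map_mul]
    rcases h with h | h <;> rw [h] <;> simp [mx_inv_mul]

lemma proj_surj (x : PSL2C) : ∃ M : SL2C, projPSL M = x := QuotientGroup.mk'_surjective _ x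

lemma tr2_proj (M : SL2C) : tr2 (projPSL M) = (trace (mx M)) ^ 2 := by
  have h : projPSL (Quotient.out (projPSL M)) = projPSL M := QuotientGroup.out_eq' (projPSL M)
  unfold tr2
  rcases (proj_eq_iff _ _).1 h with h | h
  · rw [h]; rfl
  · rw [h, trace_neg, neg_sq]; rfl

lemma tr2_conj (S x : PSL2C) : tr2 (S * x * S⁻¹) = tr2 x := by
  obtain ⟨S, rfl⟩ := proj_surj S
  obtain ⟨x, rfl⟩ := proj_surj x
  rw [← map_inv, ← map_mul, ← map_mul, tr2_proj, tr2_proj]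
  rw [map_mul, trace_mul_comm, ← map_mul]
  congr 3; group

lemma comm_proj (a c : SL2C) : Commute (projPSL a) (projPSL c) ↔
    (mx a * mx c = mx c * mx a ∨ mx a * mx c = - (mx c * mx a)) := by
  rw [commute_iff_eq, ← map_mul, ← map_mul, eq_comm, proj_eq_iff]
  simp

def NS (c : Matrix (Fin 2) (Fin 2) ℂ) : Prop := ¬ (c 0 1 = 0 ∧ c 1 0 = 0 ∧ c 0 0 = c 1 1)

lemma proj_eq_one (c : SL2C) : projPSL c = 1 ↔ ¬ NS (mx c) := by
  unfold NS
  rw [not_not, ← map_one projPSL, eq_comm, proj_eq_iff]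
  constructor
  · rintro (h | h) <;> rw [h] <;> simp
  · rintro ⟨h1, h2, h3⟩
    have hd := mx_det c
    rw [det_fin_two, h1, h3] at hd
    have : (mx c 1 1) = 1 ∨ mx c 1 1 = -1 := by
      apply sq_eq_one_x; linear_combination hd
    rcases this with h | h
    · left; ext i j; fin_cases i <;> fin_cases j <;> simp [h1, h2, h3, h]
    · right; ext i j; fin_cases i <;> fin_cases j <;> simp [h1, h2, h3, h]

lemma span_of_comm {c s : Matrix (Fin 2) (Fin 2) ℂ} (hc : NS c) (h : s * c = c * s) :
    ∃ x y : ℂ, s = x • 1 + y • c := by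
  have h00 := congrFun (congrFun h 0) 0
  have h01 := congrFun (congrFun h 0) 1
  have h10 := congrFun (congrFun h 1) 0
  simp only [mul_apply, Fin.sum_univ_two] at h00 h01 h10
  have key : ∀ y : ℂ, s 0 1 = y * c 0 1 → s 1 0 = y * c 1 0 →
      s 0 0 - s 1 1 = y * (c 0 0 - c 1 1) → ∃ x y : ℂ, s = x • 1 + y • c := by
    intro y h1 h2 h3
    refine ⟨s 0 0 - y * c 0 0, y, ?_⟩
    ext i j; fin_cases i <;> fin_cases j <;> simp [h1, h2]
    linear_combination -h3
  by_cases h1 : c 0 1 = 0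
  · by_cases h2 : c 1 0 = 0
    · have h3 : c 0 0 - c 1 1 ≠ 0 := fun h3 => hc ⟨h1, h2, sub_eq_zero.1 h3⟩
      refine key ((s 0 0 - s 1 1) / (c 0 0 - c 1 1)) ?_ ?_ ?_ <;> field_simp
      · linear_combination -h01
      · linear_combination h10
    · refine key (s 1 0 / c 1 0) ?_ ?_ ?_ <;> field_simp
      · linear_combination h00
      · linear_combination -h10
  · refine key (s 0 1 / c 0 1) ?_ ?_ ?_ <;> field_simp
    · linear_combination -h00
    · linear_combination h01

lemma comm_of_comm {c s a : Matrix (Fin 2) (Fin 2) ℂ} (hc : NS c) (h : s * c = c * s)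
    (h' : a * c = c * a) : a * s = s * a := by
  obtain ⟨x, y, rfl⟩ := span_of_comm hc h
  simp [mul_add, add_mul, h']

lemma eig_of_comm {c s : Matrix (Fin 2) (Fin 2) ℂ} (hc : NS c) (h : s * c = c * s)
    {v : Fin 2 → ℂ} {l : ℂ} (hv : c *ᵥ v = l • v) : ∃ m : ℂ, s *ᵥ v = m • v := by
  obtain ⟨x, y, rfl⟩ := span_of_comm hc h
  refine ⟨x + y * l, ?_⟩
  rw [add_mulVec, smul_mulVec, smul_mulVec, hv, one_mulVec, smul_smul, add_smul]

lemma trace_of_eig (M : SL2C) {v : Fin 2 → ℂ} (hv : v ≠ 0) {l : ℂ} (h : mx M *ᵥ v = l • v) :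
    trace (mx M) = l + l⁻¹ := by
  have h0 := congrFun h 0
  have h1 := congrFun h 1
  simp only [mulVec, dotProduct, Fin.sum_univ_two, Pi.smul_apply, smul_eq_mul] at h0 h1
  have hd := mx_det M
  rw [det_fin_two] at hd
  rw [trace_fin_two]
  have hl : l ^ 2 - (mx M 0 0 + mx M 1 1) * l + 1 = 0 := by
    by_cases hv0 : v 0 = 0
    · have hv1 : v 1 ≠ 0 := fun hv1 => hv (by ext i; fin_cases i <;> simp [hv0, hv1])
      apply mul_right_cancel₀ hv1
      linear_combination -hd * v 1 + (mx M 0 0 - l) * h1 - mx M 1 0 * h0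
    · apply mul_right_cancel₀ hv0
      linear_combination -hd * v 0 + (mx M 1 1 - l) * h0 - mx M 0 1 * h1
  have hl0 : l ≠ 0 := by rintro rfl; simp at hl
  field_simp
  linear_combination -hl

lemma eig_inv (M : SL2C) {v : Fin 2 → ℂ} (hv : v ≠ 0) {l : ℂ} (h : mx M *ᵥ v = l • v) :
    l ≠ 0 ∧ mx (M⁻¹) *ᵥ v = l⁻¹ • v := by
  have h1 : mx (M⁻¹) *ᵥ (mx M *ᵥ v) = v := by
    rw [mulVec_mulVec, ← map_mul]; simp
  rw [h, mulVec_smul] at h1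
  have hl : l ≠ 0 := by
    rintro rfl
    simp at h1; exact hv h1.symm
  refine ⟨hl, ?_⟩
  nth_rw 2 [← h1]
  rw [smul_smul, inv_mul_cancel₀ hl, one_smul]

/-- stabilizer of a line -/
def LFix (v : Fin 2 → ℂ) (hv : v ≠ 0) : Subgroup PSL2C where
  carrier := {x | ∃ M, projPSL M = x ∧ ∃ c : ℂ, mx M *ᵥ v = c • v}
  one_mem' := ⟨1, map_one _, 1, by simp⟩
  mul_mem' := by
    rintro _ _ ⟨M, rfl, c, hc⟩ ⟨N, rfl, d, hd⟩
    exact ⟨M * N, map_mul _ _ _, d * c, by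
      rw [map_mul, ← mulVec_mulVec, hd, mulVec_smul, hc, smul_smul]⟩
  inv_mem' := by
    rintro _ ⟨M, rfl, c, hc⟩
    exact ⟨M⁻¹, map_inv _ _, c⁻¹, (eig_inv M hv hc).2⟩

lemma mem_LFix {v : Fin 2 → ℂ} (hv : v ≠ 0) (M : SL2C) :
    projPSL M ∈ LFix v hv ↔ ∃ c : ℂ, mx M *ᵥ v = c • v := by
  constructor
  · rintro ⟨N, hN, c, hc⟩
    rcases (proj_eq_iff _ _).1 hN with h | h
    · exact ⟨c, by rw [h, hc]⟩
    · exact ⟨-c, by rw [h, neg_mulVec, hc, neg_smul]⟩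
  · rintro ⟨c, hc⟩
    exact ⟨M, rfl, c, hc⟩

lemma isRed_iff {G : Type*} [Group G] (ρ : G →* PSL2C) :
    IsReducibleRep ρ ↔ ∃ v, ∃ hv : v ≠ 0, ∀ g, ρ g ∈ LFix v hv := by
  constructor
  · rintro ⟨v, hv, h⟩
    refine ⟨v, hv, fun g => ?_⟩
    obtain ⟨M, hM⟩ := proj_surj (ρ g)
    rw [← hM, mem_LFix]; exact h g M hM
  · rintro ⟨v, hv, h⟩
    refine ⟨v, hv, fun g M hM => ?_⟩
    have := h g
    rwa [← hM, mem_LFix] at this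

lemma continuous_mx : Continuous (mx : SL2C → Matrix (Fin 2) (Fin 2) ℂ) :=
  continuous_induced_dom

lemma continuous_to_SL {X : Type*} [TopologicalSpace X] {f : X → SL2C}
    (h : Continuous fun x => mx (f x)) : Continuous f :=
  continuous_induced_rng.2 h

lemma continuous_proj : Continuous projPSL := continuous_quot_mk

lemma path_mem {E : Set PSL2C} (f : ℂ → SL2C) (hf : Continuous fun x => mx (f x))
    {z₀ : ℂ} (h0 : projPSL (f z₀) = 1) (hE : ∀ z, ∀ e ∈ E, Commute e (projPSL (f z))) (z : ℂ) :
    MemIdCompCentralizer E (projPSL (f z)) := by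
  have hm : ∀ z, projPSL (f z) ∈ Subgroup.centralizer E := fun z => by
    rw [Subgroup.mem_centralizer_iff]; exact fun e he => hE z e he
  refine ⟨hm z, ?_⟩
  let F : ℂ → ↥(Subgroup.centralizer E) := fun z => ⟨projPSL (f z), hm z⟩
  have hF : Continuous F :=
    Continuous.subtype_mk (continuous_proj.comp (continuous_to_SL hf)) _
  have hF0 : F z₀ = 1 := Subtype.ext h0
  have := (isPreconnected_univ (α := ℂ)).image F hF.continuousOn
  exact this.subset_connectedComponent (x := 1) ⟨z₀, trivial, hF0⟩ ⟨z, trivial, rfl⟩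

/-- trace of the commutator of lifts -/
def cf (c : SL2C) (M : SL2C) : ℂ := trace (mx M * mx c * mx M⁻¹ * mx c⁻¹)

lemma cf_congr (c M N : SL2C) (h : projPSL M = projPSL N) : cf c M = cf c N := by
  unfold cf
  rcases (proj_eq_iff _ _).1 h with h | h
  · rw [mx_inj h]
  · simp only [mx_inv N, h, mx_inv M]
    congr 1
    rw [show (!![(-mx M) 1 1, -(-mx M) 0 1; -(-mx M) 1 0, (-mx M) 0 0])
      = - !![mx M 1 1, -mx M 0 1; -mx M 1 0, mx M 0 0] by
        ext i j; fin_cases i <;> fin_cases j <;> simp]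
    simp only [Matrix.neg_mul, Matrix.mul_neg, neg_neg]

lemma continuous_cf (c : SL2C) : Continuous (cf c) := by
  unfold cf
  have h : ∀ i j, Continuous fun M => mx M i j := fun i j =>
    continuous_mx.matrix_elem i j
  have h1 : Continuous fun M : SL2C => mx M⁻¹ := by
    simp only [mx_inv]
    refine continuous_matrix fun i j => ?_
    have := h 0 0; have := h 0 1; have := h 1 0; have := h 1 1
    fin_cases i <;> fin_cases j <;> simp <;> fun_prop
  have := continuous_mx
  refine Continuous.matrix_trace ?_
  exact ((this.mul continuous_const).mul h1).mul continuous_const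

lemma comm_iff_conj (c M : SL2C) : mx M * mx c = mx c * mx M →
    mx M * mx c * mx M⁻¹ * mx c⁻¹ = 1 := by
  intro h
  rw [h, mul_assoc (mx c), mx_mul_inv, mul_one, mx_mul_inv]

lemma comp_comm {E : Set PSL2C} {c M : SL2C} (hc : projPSL c ∈ E)
    (h : MemIdCompCentralizer E (projPSL M)) : mx M * mx c = mx c * mx M := by
  obtain ⟨hM, hcomp⟩ := h
  let φ : PSL2C → ℂ := fun x => cf c (Quotient.out x)
  have hφ : ∀ N, φ (projPSL N) = cf c N := fun N => cf_congr _ _ _ (QuotientGroup.out_eq' _)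
  have hcont : Continuous φ := by
    have hq : Topology.IsQuotientMap (projPSL : SL2C → PSL2C) := isQuotientMap_quot_mk
    rw [hq.continuous_iff]
    have : φ ∘ projPSL = cf c := funext hφ
    rw [this]; exact continuous_cf c
  let ψ : ↥(Subgroup.centralizer E) → ℂ := fun x => φ x
  have hψ : Continuous ψ := hcont.comp continuous_subtype_val
  have hneg : ∀ N : SL2C, mx N * mx c = -(mx c * mx N) → cf c N = -2 := by
    intro N hN
    unfold cf
    rw [hN, neg_mul, mul_assoc (mx c), mx_mul_inv, mul_one, neg_mul, mx_mul_inv]; simp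
  have hpos : ∀ N : SL2C, mx N * mx c = (mx c * mx N) → cf c N = 2 := by
    intro N hN
    unfold cf
    rw [comm_iff_conj _ _ hN]; simp
  have hval : ∀ x, ψ x ∈ ({2, -2} : Set ℂ) := by
    rintro ⟨x, hx⟩
    obtain ⟨N, rfl⟩ := proj_surj x
    have : Commute (projPSL N) (projPSL c) := (Subgroup.mem_centralizer_iff.1 hx _ hc).symm
    change φ (projPSL N) ∈ _
    rw [hφ]
    rcases (comm_proj _ _).1 this with h | h
    · left; exact hpos _ h
    · right; exact hneg _ h
  have hpre : IsPreconnected (ψ '' connectedComponent 1) :=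
    isPreconnected_connectedComponent.image ψ hψ.continuousOn
  have hsub : (ψ '' connectedComponent 1).Subsingleton := by
    refine (Set.toFinite ({2, -2} : Set ℂ)).countable.isTotallyDisconnected _ ?_ hpre
    rintro _ ⟨x, -, rfl⟩
    exact hval x
  have h1 : ψ 1 = 2 := by
    change φ 1 = 2
    rw [← map_one projPSL, hφ]; exact hpos _ (by simp)
  have h2 : ψ ⟨_, hM⟩ = 2 := by
    rw [← h1]
    exact hsub ⟨_, hcomp, rfl⟩ ⟨_, mem_connectedComponent, rfl⟩
  change φ (projPSL M) = 2 at h2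
  rw [hφ] at h2
  have : Commute (projPSL M) (projPSL c) := (Subgroup.mem_centralizer_iff.1 hM _ hc).symm
  rcases (comm_proj _ _).1 this with h | h
  · exact h
  · rw [hneg _ h] at h2; norm_num at h2

lemma not_NS_comm {c : Matrix (Fin 2) (Fin 2) ℂ} (hc : ¬ NS c)
    (d : Matrix (Fin 2) (Fin 2) ℂ) : c * d = d * c := by
  unfold NS at hc
  rw [not_not] at hc
  obtain ⟨h1, h2, h3⟩ := hc
  ext i j; fin_cases i <;> fin_cases j <;>
    simp only [Fin.zero_eta, Fin.mk_one, mul_apply, Fin.sum_univ_two, h1, h2, h3] <;> ring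

lemma mul_ne_neg (c d : SL2C) : mx c * mx d ≠ -(mx c * mx d) := by
  intro h
  have h2 : mx c * mx d = 0 := by
    ext i j
    exact self_eq_neg.1 (congrFun (congrFun h i) j)
  have := mx_det (c * d)
  rw [map_mul, h2] at this
  simp at this

lemma anti_sq {c d : SL2C} (h : mx c * mx d = -(mx d * mx c)) : projPSL c * projPSL c = 1 := by
  have ht : trace (mx c) = 0 := by
    have : mx c = -(mx d * mx c * mx d⁻¹) := by
      rw [← neg_mul, ← h, mul_assoc, mx_mul_inv, mul_one]
    have h2 : trace (mx c) = -trace (mx c) := by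
      conv_lhs => rw [this]
      rw [trace_neg, trace_mul_comm, ← mul_assoc, mx_inv_mul, one_mul]
    exact self_eq_neg.1 h2
  rw [← map_mul, proj_eq_one, map_mul]
  unfold NS
  rw [not_not]
  rw [trace_fin_two] at ht
  simp only [mul_apply, Fin.sum_univ_two]
  refine ⟨?_, ?_, ?_⟩
  · linear_combination mx c 0 1 * ht
  · linear_combination mx c 1 0 * ht
  · linear_combination (mx c 0 0 - mx c 1 1) * ht

lemma comm_both {c d e : SL2C} (h : mx c * mx d = -(mx d * mx c))
    (h1 : mx e * mx c = mx c * mx e) (h2 : mx e * mx d = mx d * mx e) : projPSL e = 1 := by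
  by_contra he
  rw [proj_eq_one, not_not] at he
  have := comm_of_comm he h1.symm h2.symm
  rw [this] at h
  exact mul_ne_neg c d h

lemma klein (R : Subgroup PSL2C) (hab : ∀ x ∈ R, ∀ y ∈ R, Commute x y) (c d : SL2C)
    (hc : projPSL c ∈ R) (hd : projPSL d ∈ R) (h : mx c * mx d = -(mx d * mx c)) :
    IsKleinFour R := by
  have h' : mx d * mx c = -(mx c * mx d) := by rw [h, neg_neg]
  have hcc := anti_sq h
  have hdd := anti_sq h'
  have hCD := hab _ hc _ hd
  have hc1 : projPSL c ≠ 1 := fun hh => by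
    rw [proj_eq_one] at hh
    exact mul_ne_neg c d (by rw [← not_NS_comm hh] at h; exact h)
  have hd1 : projPSL d ≠ 1 := fun hh => by
    rw [proj_eq_one] at hh
    exact mul_ne_neg d c (by rw [← not_NS_comm hh] at h'; exact h')
  have hcd : projPSL c ≠ projPSL d := fun hh => by
    rcases (proj_eq_iff _ _).1 hh with hh | hh <;> rw [hh] at h
    · exact mul_ne_neg c c h
    · simp only [mul_neg, neg_mul, neg_neg] at h
      exact mul_ne_neg c c h.symm
  have hR : (R : Set PSL2C) = {1, projPSL c, projPSL d, projPSL c * projPSL d} := by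
    ext x
    simp only [SetLike.mem_coe, Set.mem_insert_iff, Set.mem_singleton_iff]
    constructor
    · intro hx
      obtain ⟨e, rfl⟩ := proj_surj x
      rcases (comm_proj _ _).1 (hab _ hx _ hc) with h1 | h1 <;>
      rcases (comm_proj _ _).1 (hab _ hx _ hd) with h2 | h2
      · left; exact comm_both h h1 h2
      · right; left
        have : projPSL (e * c) = 1 := by
          apply comm_both h <;> simp only [map_mul]
          · rw [h1, mul_assoc, h1]
          · rw [mul_assoc, h, mul_neg, ← mul_assoc, h2, neg_mul, neg_neg, mul_assoc]
        rw [map_mul] at this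
        rw [eq_inv_of_mul_eq_one_left this, inv_eq_of_mul_eq_one_left hcc]
      · right; right; left
        have : projPSL (e * d) = 1 := by
          apply comm_both h <;> simp only [map_mul]
          · rw [mul_assoc, h', mul_neg, ← mul_assoc, h1, neg_mul, neg_neg, mul_assoc]
          · rw [h2, mul_assoc, h2]
        rw [map_mul] at this
        rw [eq_inv_of_mul_eq_one_left this, inv_eq_of_mul_eq_one_left hdd]
      · right; right; right
        have : projPSL (e * (c * d)) = 1 := by
          apply comm_both h <;> simp only [map_mul]
          · calc mx e * (mx c * mx d) * mx c = mx e * mx c * (mx d * mx c) := by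
                  simp only [mul_assoc]
              _ = mx c * (mx e * (mx c * mx d)) := by
                  rw [h1, h']; simp only [mul_assoc, mul_neg, neg_mul, neg_neg]
          · calc mx e * (mx c * mx d) * mx d = - (mx e * mx d * (mx c * mx d)) := by
                  rw [mul_assoc (mx e) (mx d), ← mul_assoc (mx d), h', neg_mul, mul_neg, neg_neg]
                  simp only [mul_assoc]
              _ = mx d * (mx e * (mx c * mx d)) := by
                  rw [h2]; simp only [mul_assoc, mul_neg, neg_mul, neg_neg]
        rw [map_mul, map_mul] at this
        rw [eq_inv_of_mul_eq_one_left this, _root_.mul_inv_rev, inv_eq_of_mul_eq_one_left hdd,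
          inv_eq_of_mul_eq_one_left hcc]
        exact hCD.symm
    · rintro (rfl | rfl | rfl | rfl)
      · exact R.one_mem
      · exact hc
      · exact hd
      · exact R.mul_mem hc hd
  have hsq : ∀ x ∈ R, x ^ 2 = 1 := by
    intro x hx
    have hx : x ∈ (R : Set PSL2C) := hx
    rw [hR] at hx
    rcases hx with rfl | rfl | rfl | rfl
    · simp
    · rw [sq, hcc]
    · rw [sq, hdd]
    · rw [hCD.mul_pow, sq, sq, hcc, hdd, one_mul]
  refine ⟨?_, ?_⟩
  · change Nat.card (R : Set PSL2C) = 4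
    rw [Nat.card_coe_set_eq, hR]
    have e1 : projPSL c * projPSL d ≠ 1 := fun hh => hcd (by
      rw [eq_inv_of_mul_eq_one_left hh, inv_eq_of_mul_eq_one_left hdd])
    rw [Set.ncard_insert_of_notMem, Set.ncard_insert_of_notMem, Set.ncard_pair]
    · intro hh; exact hc1 (right_eq_mul.1 hh)
    · rintro (hh | hh)
      · exact hcd hh
      · exact hd1 (left_eq_mul.1 hh)
    · rintro (hh | hh | hh)
      · exact hc1 hh.symm
      · exact hd1 hh.symm
      · exact e1 hh.symm
  · have hdvd : Monoid.exponent R ∣ 2 :=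
      Monoid.exponent_dvd_of_forall_pow_eq_one fun x => Subtype.ext (hsq x x.2)
    rcases (Nat.dvd_prime Nat.prime_two).1 hdvd with h1 | h1
    · exfalso
      have := Monoid.pow_exponent_eq_one (⟨_, hc⟩ : R)
      rw [h1, pow_one] at this
      exact hc1 (congrArg Subtype.val this)
    · exact h1

lemma quad_const {α β γ : ℂ} (h : ∀ s : ℂ, (α + β * s + γ * s ^ 2) ^ 2 = α ^ 2) :
    γ = 0 ∧ β = 0 := by
  have h1 := h 1
  have h2 := h (-1)
  have h3 := h 2
  have h4 := h (-2)
  have hg : γ ^ 2 = 0 := by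
    linear_combination (1 / 24) * (h3 + h4 - 4 * h1 - 4 * h2)
  have hg : γ = 0 := by simpa using hg
  subst hg
  refine ⟨rfl, ?_⟩
  have hb : β ^ 2 = 0 := by linear_combination (1 / 2) * (h1 + h2)
  simpa using hb

lemma laurent_const {α β γ K : ℂ} (h : ∀ u : ℂ, u ≠ 0 → (α + β * u⁻¹ + γ * u) ^ 2 = K) :
    β = 0 ∧ γ = 0 := by
  have h1 := h 1 (by simp)
  have h2 := h (-1) (by simp)
  have h3 := h 2 (by simp)
  have h4 := h (-2) (by simp)
  have h5 := h 4 (by simp)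
  have h6 := h (-4) (by simp)
  norm_num at h1 h2 h3 h4 h5 h6
  have e1 : β ^ 2 + γ ^ 2 + (α ^ 2 + 2 * β * γ - K) = 0 := by linear_combination (h1 + h2) / 2
  have e2 : β ^ 2 / 4 + 4 * γ ^ 2 + (α ^ 2 + 2 * β * γ - K) = 0 := by
    linear_combination (h3 + h4) / 2
  have e3 : β ^ 2 / 16 + 16 * γ ^ 2 + (α ^ 2 + 2 * β * γ - K) = 0 := by
    linear_combination (h5 + h6) / 2
  have hb : β ^ 2 = 0 := by
    linear_combination (64 / 45) * (e1 - e2) - 64 / 45 * (1 / 4) * (e2 - e3)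
  have hg : γ ^ 2 = 0 := by
    linear_combination hb / 4 - (e1 - e2) / 3
  exact ⟨by simpa using hb, by simpa using hg⟩

/-- diagonal one-parameter group -/
def Dz (z : ℂ) : SL2C := ⟨!![Complex.exp z, 0; 0, Complex.exp (-z)], by
  simp [det_fin_two, ← Complex.exp_add]⟩

/-- unipotent one-parameter group -/
def Uz (z : ℂ) : SL2C := ⟨!![1, z; 0, 1], by simp [det_fin_two]⟩

/-- lower unipotent one-parameter group -/
def Lz (z : ℂ) : SL2C := ⟨!![1, 0; z, 1], by simp [det_fin_two]⟩

/-- the rotation by a quarter turn -/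
def Jz : SL2C := ⟨!![0, -1; 1, 0], by simp [det_fin_two]⟩

lemma mx_Dz (z : ℂ) : mx (Dz z) = !![Complex.exp z, 0; 0, Complex.exp (-z)] := rfl
lemma mx_Uz (z : ℂ) : mx (Uz z) = !![1, z; 0, 1] := rfl
lemma mx_Lz (z : ℂ) : mx (Lz z) = !![1, 0; z, 1] := rfl
lemma mx_Jz : mx Jz = !![0, -1; 1, 0] := rfl

lemma Uz_zero : Uz 0 = 1 := mx_inj (by rw [mx_Uz, map_one]; ext i j; fin_cases i <;> fin_cases j <;> simp)
lemma Dz_zero : Dz 0 = 1 := mx_inj (by rw [mx_Dz, map_one]; ext i j; fin_cases i <;> fin_cases j <;> simp)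

lemma continuous_Uz : Continuous fun z => mx (Uz z) := by
  simp only [mx_Uz]
  refine continuous_matrix fun i j => ?_
  fin_cases i <;> fin_cases j <;> simp <;> fun_prop

lemma continuous_Dz : Continuous fun z => mx (Dz z) := by
  simp only [mx_Dz]
  refine continuous_matrix fun i j => ?_
  fin_cases i <;> fin_cases j <;> simp <;> fun_prop

lemma core_U (a b : SL2C)
    (h : ∀ z, (trace (mx (a * Uz z * b * (Uz z)⁻¹))) ^ 2 = (trace (mx (a * b))) ^ 2) :
    mx a 1 0 * mx b 1 0 = 0 ∧
    (mx a 0 0 - mx a 1 1) * mx b 1 0 + mx a 1 0 * (mx b 1 1 - mx b 0 0) = 0 := by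
  have := quad_const (α := trace (mx (a * b)))
    (β := (mx a 0 0 - mx a 1 1) * mx b 1 0 + mx a 1 0 * (mx b 1 1 - mx b 0 0))
    (γ := -(mx a 1 0 * mx b 1 0)) (fun s => by
      rw [← h s]; congr 1
      simp only [map_mul, mx_inv (Uz s), mx_Uz, trace_fin_two, mul_apply, Fin.sum_univ_two]
      simp; ring)
  exact ⟨neg_eq_zero.1 this.1, this.2⟩

lemma core_D (a b : SL2C)
    (h : ∀ z, (trace (mx (a * Dz z * b * (Dz z)⁻¹))) ^ 2 = (trace (mx (a * b))) ^ 2) :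
    mx a 0 1 * mx b 1 0 = 0 ∧ mx a 1 0 * mx b 0 1 = 0 := by
  refine laurent_const (α := mx a 0 0 * mx b 0 0 + mx a 1 1 * mx b 1 1)
    (K := (trace (mx (a * b))) ^ 2) (fun u hu => ?_)
  obtain ⟨w, rfl⟩ : ∃ w, u = Complex.exp w := ⟨Complex.log u, (Complex.exp_log hu).symm⟩
  rw [← h (w / 2)]
  have e1 : Complex.exp w = Complex.exp (w / 2) * Complex.exp (w / 2) := by
    rw [← Complex.exp_add]; ring_nf
  have e2 : Complex.exp (-(w / 2)) = (Complex.exp (w / 2))⁻¹ := Complex.exp_neg _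
  congr 1
  simp only [map_mul, mx_inv (Dz _), mx_Dz, trace_fin_two, mul_apply, Fin.sum_univ_two]
  have := Complex.exp_ne_zero (w / 2)
  simp only [e2, e1]
  simp
  field_simp
  ring

lemma trace_conj (P M : SL2C) : trace (mx (P * M * P⁻¹)) = trace (mx M) := by
  rw [map_mul, trace_mul_comm, ← map_mul]
  congr 2; group

lemma NS_conj (P c : SL2C) (h : NS (mx c)) : NS (mx (P * c * P⁻¹)) := by
  by_contra hh
  rw [← proj_eq_one] at hh
  rw [map_mul, map_mul, map_inv, conj_eq_one_iff] at hh
  exact (proj_eq_one c).1 hh h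

lemma conj_L (y : ℂ) (a : SL2C) : mx (Lz y * a * (Lz y)⁻¹) 1 0 =
    mx a 1 0 + (mx a 0 0 - mx a 1 1) * y - mx a 0 1 * y ^ 2 := by
  simp only [map_mul, mx_inv (Lz _), mx_Lz, mul_apply, Fin.sum_univ_two]
  simp; ring

lemma quad_root (p q r : ℂ) (hr : r ≠ 0) : ∃ y : ℂ, p + q * y - r * y ^ 2 = 0 := by
  obtain ⟨s, hs⟩ := IsAlgClosed.exists_pow_nat_eq (q ^ 2 + 4 * r * p) (n := 2) (by norm_num)
  refine ⟨(q + s) / (2 * r), ?_⟩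
  field_simp
  linear_combination -hs

lemma normal1 (c : SL2C) : ∃ P : SL2C, mx (P * c * P⁻¹) 1 0 = 0 := by
  by_cases h : mx c 0 1 = 0
  · refine ⟨Jz, ?_⟩
    simp only [map_mul, mx_inv Jz, mx_Jz, mul_apply, Fin.sum_univ_two]
    simp [h]
  · obtain ⟨y, hy⟩ := quad_root (mx c 1 0) (mx c 0 0 - mx c 1 1) _ h
    exact ⟨Lz y, by rw [conj_L, hy]⟩

lemma normal_form (c : SL2C) (hc : NS (mx c)) : ∃ P : SL2C, mx (P * c * P⁻¹) 1 0 = 0 ∧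
    ((mx (P * c * P⁻¹) 0 1 = 0 ∧ mx (P * c * P⁻¹) 0 0 ≠ mx (P * c * P⁻¹) 1 1) ∨
      (mx (P * c * P⁻¹) 0 1 ≠ 0 ∧ mx (P * c * P⁻¹) 0 0 = mx (P * c * P⁻¹) 1 1)) := by
  obtain ⟨P, hP⟩ := normal1 c
  have hN := NS_conj P c hc
  by_cases h : mx (P * c * P⁻¹) 0 0 = mx (P * c * P⁻¹) 1 1
  · exact ⟨P, hP, Or.inr ⟨fun h2 => hN ⟨h2, hP, h⟩, h⟩⟩
  · set d := P * c * P⁻¹ with hd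
    have hs : mx d 0 0 - mx d 1 1 ≠ 0 := sub_ne_zero.2 h
    have e : ∀ y, Uz y * P * c * (Uz y * P)⁻¹ = Uz y * d * (Uz y)⁻¹ := fun y => by
      rw [hd]; group
    refine ⟨Uz (mx d 0 1 / (mx d 0 0 - mx d 1 1)) * P, ?_, Or.inl ⟨?_, ?_⟩⟩ <;> rw [e] <;>
    simp only [map_mul, mx_inv (Uz _), mx_Uz, mul_apply, Fin.sum_univ_two] <;>
    simp [hP]
    · field_simp; ring
    · exact h

lemma exists_L {a b : SL2C} (ha : NS (mx a)) (hb : NS (mx b)) :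
    ∃ y, mx (Lz y * a * (Lz y)⁻¹) 1 0 * mx (Lz y * b * (Lz y)⁻¹) 1 0 ≠ 0 := by
  by_contra! hh
  let p : SL2C → Polynomial ℂ := fun a => Polynomial.C (mx a 1 0) +
    Polynomial.C (mx a 0 0 - mx a 1 1) * Polynomial.X - Polynomial.C (mx a 0 1) * Polynomial.X ^ 2
  have hp : ∀ a, p a = 0 → ¬ NS (mx a) := by
    intro a h0
    have c0 := congrArg (fun q => Polynomial.coeff q 0) h0
    have c1 := congrArg (fun q => Polynomial.coeff q 1) h0
    have c2 := congrArg (fun q => Polynomial.coeff q 2) h0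
    simp [p, Polynomial.coeff_X, Polynomial.coeff_C, Polynomial.coeff_X_pow,
      -map_sub] at c0 c1 c2
    unfold NS
    rw [not_not]
    exact ⟨c2, c0, sub_eq_zero.1 c1⟩
  have : p a * p b = 0 := by
    apply Polynomial.funext
    intro y
    have := hh y
    rw [conj_L, conj_L] at this
    simp only [p, Polynomial.eval_mul, Polynomial.eval_add, Polynomial.eval_sub,
      Polynomial.eval_C, Polynomial.eval_X, Polynomial.eval_pow, Polynomial.eval_zero]
    exact this
  rcases mul_eq_zero.1 this with h | h
  · exact hp a h ha
  · exact hp b h hb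

lemma gen_pushout {Γ₀ Γ₁ Γ₂ Γ : Type} [Group Γ₀] [Group Γ₁] [Group Γ₂] [Group Γ]
    (j₁ : Γ₀ →* Γ₁) (j₂ : Γ₀ →* Γ₂) (i₁ : Γ₁ →* Γ) (i₂ : Γ₂ →* Γ)
    (hsquare : i₁.comp j₁ = i₂.comp j₂)
    (hpushout : ∀ (H : Type) [Group H] (f₁ : Γ₁ →* H) (f₂ : Γ₂ →* H),
      f₁.comp j₁ = f₂.comp j₂ → ∃! f : Γ →* H, f.comp i₁ = f₁ ∧ f.comp i₂ = f₂)
    (K : Subgroup Γ) (h1 : ∀ g, i₁ g ∈ K) (h2 : ∀ g, i₂ g ∈ K) (γ : Γ) : γ ∈ K := by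
  obtain ⟨f, ⟨hf1, hf2⟩, -⟩ := hpushout K (i₁.codRestrict K h1) (i₂.codRestrict K h2) (by
    ext g; exact DFunLike.congr_fun hsquare g)
  obtain ⟨f', -, huniq⟩ := hpushout Γ i₁ i₂ hsquare
  have e1 : K.subtype.comp f = f' := huniq _ ⟨by rw [MonoidHom.comp_assoc, hf1]; rfl,
    by rw [MonoidHom.comp_assoc, hf2]; rfl⟩
  have e2 : MonoidHom.id Γ = f' := huniq _ ⟨rfl, rfl⟩
  have : γ = (f γ : Γ) := DFunLike.congr_fun (e2.trans e1.symm) γ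
  rw [this]; exact (f γ).2

lemma conj_cont (P : SL2C) {f : ℂ → SL2C} (hf : Continuous fun z => mx (f z)) :
    Continuous fun z => mx (P⁻¹ * f z * P) := by
  simp only [map_mul]
  exact (continuous_const.mul hf).mul continuous_const

lemma vec_ne (P : SL2C) (w : Fin 2 → ℂ) (hw : w ≠ 0) : mx P⁻¹ *ᵥ w ≠ 0 := by
  intro h
  apply hw
  have : mx P *ᵥ (mx P⁻¹ *ᵥ w) = w := by rw [mulVec_mulVec, mx_mul_inv, one_mulVec]
  rw [← this, h, mulVec_zero]

lemma fix_aux (P a : SL2C) (w : Fin 2 → ℂ) (l : ℂ) (hv : mx P⁻¹ *ᵥ w ≠ 0)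
    (h : mx (P * a * P⁻¹) *ᵥ w = l • w) : projPSL a ∈ LFix (mx P⁻¹ *ᵥ w) hv := by
  rw [mem_LFix]
  refine ⟨l, ?_⟩
  rw [mulVec_mulVec, ← map_mul, ← mulVec_smul, ← h, mulVec_mulVec, ← map_mul]
  congr 2; group

lemma up_fix {P : SL2C} (a : SL2C) (hv : mx P⁻¹ *ᵥ ![1, 0] ≠ 0)
    (h : mx (P * a * P⁻¹) 1 0 = 0) : projPSL a ∈ LFix (mx P⁻¹ *ᵥ ![1, 0]) hv := by
  refine fix_aux P a _ (mx (P * a * P⁻¹) 0 0) hv ?_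
  ext i; fin_cases i <;> simp [mulVec, dotProduct, Fin.sum_univ_two, h, -map_mul]

lemma low_fix {P : SL2C} (a : SL2C) (hv : mx P⁻¹ *ᵥ ![0, 1] ≠ 0)
    (h : mx (P * a * P⁻¹) 0 1 = 0) : projPSL a ∈ LFix (mx P⁻¹ *ᵥ ![0, 1]) hv := by
  refine fix_aux P a _ (mx (P * a * P⁻¹) 1 1) hv ?_
  ext i; fin_cases i <;> simp [mulVec, dotProduct, Fin.sum_univ_two, h, -map_mul]

lemma diag_comm {A B : Matrix (Fin 2) (Fin 2) ℂ} (h1 : A 0 1 = 0) (h2 : A 1 0 = 0)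
    (h3 : B 0 1 = 0) (h4 : B 1 0 = 0) : A * B = B * A := by
  ext i j; fin_cases i <;> fin_cases j <;>
    simp only [Fin.zero_eta, Fin.mk_one, mul_apply, Fin.sum_univ_two, h1, h2, h3, h4] <;> ring

lemma unip_comm {A B : Matrix (Fin 2) (Fin 2) ℂ} (h1 : A 1 0 = 0) (h2 : A 0 0 = A 1 1)
    (h3 : B 1 0 = 0) (h4 : B 0 0 = B 1 1) : A * B = B * A := by
  ext i j; fin_cases i <;> fin_cases j <;>
    simp only [Fin.zero_eta, Fin.mk_one, mul_apply, Fin.sum_univ_two, h1, h2, h3, h4] <;> ring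

/-- elements whose images under two representations have lifts acting equally on a line -/
def pairSub {G : Type} [Group G] (v : Fin 2 → ℂ) (hv : v ≠ 0) (ρ σ : G →* PSL2C) :
    Subgroup G where
  carrier := {g | ∃ (M N : SL2C) (l : ℂ), projPSL M = ρ g ∧ projPSL N = σ g ∧
    mx M *ᵥ v = l • v ∧ mx N *ᵥ v = l • v}
  one_mem' := ⟨1, 1, 1, by simp, by simp, by simp, by simp⟩
  mul_mem' := by
    rintro g h ⟨M, N, l, h1, h2, h3, h4⟩ ⟨M', N', l', h1', h2', h3', h4'⟩
    refine ⟨M * M', N * N', l' * l, by rw [map_mul, map_mul, h1, h1'],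
      by rw [map_mul, map_mul, h2, h2'], ?_, ?_⟩
    · rw [map_mul, ← mulVec_mulVec, h3', mulVec_smul, h3, smul_smul]
    · rw [map_mul, ← mulVec_mulVec, h4', mulVec_smul, h4, smul_smul]
  inv_mem' := by
    rintro g ⟨M, N, l, h1, h2, h3, h4⟩
    exact ⟨M⁻¹, N⁻¹, l⁻¹, by rw [map_inv, map_inv, h1], by rw [map_inv, map_inv, h2],
      (eig_inv M hv h3).2, (eig_inv N hv h4).2⟩

/-- bending along an amalgamated free product `Γ = Γ₁ *_{Γ₀} Γ₂`. -/
theorem stmt11 {Γ₀ Γ₁ Γ₂ Γ : Type} [Group Γ₀] [Group Γ₁] [Group Γ₂] [Group Γ]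
    (j₁ : Γ₀ →* Γ₁) (j₂ : Γ₀ →* Γ₂)
    (hj₁ : Function.Injective j₁) (hj₂ : Function.Injective j₂)
    (i₁ : Γ₁ →* Γ) (i₂ : Γ₂ →* Γ)
    (hsquare : i₁.comp j₁ = i₂.comp j₂)
    -- `Γ` is the pushout (amalgamated free product) of `Γ₁ ← Γ₀ → Γ₂`:
    (hpushout : ∀ (H : Type) [Group H] (f₁ : Γ₁ →* H) (f₂ : Γ₂ →* H),
      f₁.comp j₁ = f₂.comp j₂ → ∃! f : Γ →* H, f.comp i₁ = f₁ ∧ f.comp i₂ = f₂)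
    (hfg : Group.FG Γ)
    (ρ : Γ →* PSL2C)
    -- `ρ(Γ₀)` is abelian and not isomorphic to the Klein four-group `ℤ/2 × ℤ/2`:
    (hab : ∀ g h : Γ₀, Commute (ρ (i₁ (j₁ g))) (ρ (i₁ (j₁ h))))
    (hnK4 : ¬ IsKleinFour ↥((ρ.comp (i₁.comp j₁)).range)) :
    -- the bending function is constant:
    (∀ S : PSL2C, MemIdCompCentralizer (↑(ρ.comp (i₁.comp j₁)).range) S →
      ∀ ρS : Γ →* PSL2C,
        ((∀ g : Γ₁, ρS (i₁ g) = ρ (i₁ g)) ∧ (∀ g : Γ₂, ρS (i₂ g) = S * ρ (i₂ g) * S⁻¹)) →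
        ∀ γ : Γ, tr2 (ρS γ) = tr2 (ρ γ)) ↔
    -- if and only if (a) or (b) holds:
    (((∀ g : Γ₀, ρ (i₁ (j₁ g)) = 1) ∧
        ((∀ g : Γ₁, ρ (i₁ g) = 1) ∨ (∀ g : Γ₂, ρ (i₂ g) = 1))) ∨
      ((¬ ∀ g : Γ₀, ρ (i₁ (j₁ g)) = 1) ∧
        (((∀ g h : Γ₁, Commute (ρ (i₁ g)) (ρ (i₁ h))) ∧ IsReducibleRep (ρ.comp i₁)) ∨
          ((∀ g h : Γ₂, Commute (ρ (i₂ g)) (ρ (i₂ h))) ∧ IsReducibleRep (ρ.comp i₂)) ∨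
          IsReducibleRep ρ))) := by
  have hgen := gen_pushout j₁ j₂ i₁ i₂ hsquare hpushout
  have hsq : ∀ g, i₁ (j₁ g) = i₂ (j₂ g) := fun g => DFunLike.congr_fun hsquare g
  have hE : ∀ g, ρ (i₁ (j₁ g)) ∈ ((ρ.comp (i₁.comp j₁)).range : Set PSL2C) := fun g => ⟨g, rfl⟩
  constructor
  · intro hconst
    have H : ∀ S : SL2C, MemIdCompCentralizer (↑(ρ.comp (i₁.comp j₁)).range) (projPSL S) →
        ∀ (g : Γ₁) (h : Γ₂) (a b : SL2C), projPSL a = ρ (i₁ g) → projPSL b = ρ (i₂ h) →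
          (trace (mx (a * S * b * S⁻¹))) ^ 2 = (trace (mx (a * b))) ^ 2 := by
      intro S hS g h a b ha hb
      obtain ⟨ρS, ⟨h1, h2⟩, -⟩ := hpushout PSL2C (ρ.comp i₁)
        ((MulAut.conj (projPSL S)).toMonoidHom.comp (ρ.comp i₂)) (by
          ext g
          have := Subgroup.mem_centralizer_iff.1 hS.1 _ (hE g)
          simp only [MonoidHom.comp_apply, MulEquiv.coe_toMonoidHom, MulAut.conj_apply, ← hsq]
          rw [← this, mul_inv_cancel_right])
      have h1' : ∀ g, ρS (i₁ g) = ρ (i₁ g) := fun g => DFunLike.congr_fun h1 g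
      have h2' : ∀ g, ρS (i₂ g) = projPSL S * ρ (i₂ g) * (projPSL S)⁻¹ :=
        fun g => DFunLike.congr_fun h2 g
      have := hconst _ hS ρS ⟨h1', h2'⟩ (i₁ g * i₂ h)
      rw [map_mul, map_mul, h1', h2', ← ha, ← hb, ← map_inv, ← map_mul, ← map_mul, ← map_mul,
        ← map_mul, tr2_proj, tr2_proj] at this
      rw [← this]; simp only [mul_assoc]
    have HP : ∀ P S : SL2C,
        MemIdCompCentralizer (↑(ρ.comp (i₁.comp j₁)).range) (projPSL (P⁻¹ * S * P)) →
        ∀ (g : Γ₁) (h : Γ₂) (a b : SL2C), projPSL a = ρ (i₁ g) → projPSL b = ρ (i₂ h) →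
          (trace (mx ((P * a * P⁻¹) * S * (P * b * P⁻¹) * S⁻¹))) ^ 2
            = (trace (mx ((P * a * P⁻¹) * (P * b * P⁻¹)))) ^ 2 := by
      intro P S hS g h a b ha hb
      have := H _ hS g h a b ha hb
      rw [← trace_conj P, ← trace_conj P (a * b)] at this
      convert this using 4
      · group
      · group
    by_cases htriv : ∀ g : Γ₀, ρ (i₁ (j₁ g)) = 1
    · refine Or.inl ⟨htriv, ?_⟩
      by_contra! hcon
      obtain ⟨⟨g, hg⟩, ⟨h, hh⟩⟩ := hcon
      obtain ⟨a, ha⟩ := proj_surj (ρ (i₁ g))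
      obtain ⟨b, hb⟩ := proj_surj (ρ (i₂ h))
      have haN : NS (mx a) := by
        by_contra hN; rw [← proj_eq_one, ha] at hN; exact hg hN
      have hbN : NS (mx b) := by
        by_contra hN; rw [← proj_eq_one, hb] at hN; exact hh hN
      obtain ⟨y, hy⟩ := exists_L haN hbN
      refine hy (core_U _ _ fun z => HP (Lz y) (Uz z) ?_ g h a b ha hb).1
      refine path_mem (fun z => (Lz y)⁻¹ * Uz z * Lz y) (conj_cont _ continuous_Uz) (z₀ := 0)
        (by simp [Uz_zero]) ?_ z
      rintro z _ ⟨g, rfl⟩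
      change Commute (ρ (i₁ (j₁ g))) _
      rw [htriv g]; exact Commute.one_left _
    · refine Or.inr ⟨htriv, ?_⟩
      push Not at htriv
      obtain ⟨g₀, hg₀⟩ := htriv
      obtain ⟨c, hc⟩ := proj_surj (ρ (i₁ (j₁ g₀)))
      have hcN : NS (mx c) := by
        by_contra hN; rw [← proj_eq_one, hc] at hN; exact hg₀ hN
      have hcomm : ∀ (g : Γ₀) (e : SL2C), projPSL e = ρ (i₁ (j₁ g)) →
          mx e * mx c = mx c * mx e := by
        intro g e he
        have h1 := hab g g₀
        rw [← he, ← hc, comm_proj] at h1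
        rcases h1 with h1 | h1
        · exact h1
        · exfalso
          refine hnK4 (klein _ ?_ e c ⟨g, he.symm⟩ ⟨g₀, hc.symm⟩ h1)
          rintro _ ⟨x, rfl⟩ _ ⟨y, rfl⟩
          exact hab x y
      obtain ⟨P, hP10, hP⟩ := normal_form c hcN
      have hmem : ∀ f : ℂ → SL2C, (Continuous fun z => mx (f z)) → f 0 = 1 →
          (∀ z, mx (f z) * mx (P * c * P⁻¹) = mx (P * c * P⁻¹) * mx (f z)) →
          ∀ z, MemIdCompCentralizer (↑(ρ.comp (i₁.comp j₁)).range)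
            (projPSL (P⁻¹ * f z * P)) := by
        intro f hf hf0 hfc z
        refine path_mem (fun z => P⁻¹ * f z * P) (conj_cont _ hf) (z₀ := 0)
          (by simp [hf0]) ?_ z
        rintro z _ ⟨g, rfl⟩
        obtain ⟨e, he⟩ := proj_surj (ρ (i₁ (j₁ g)))
        change Commute (ρ (i₁ (j₁ g))) _
        rw [← he, comm_proj]
        left
        refine comm_of_comm hcN ?_ (hcomm g e he)
        have h1 : f z * (P * c * P⁻¹) = (P * c * P⁻¹) * f z := mx_inj (by
          rw [map_mul, hfc, ← map_mul])
        have h2 : (P⁻¹ * f z * P) * c = c * (P⁻¹ * f z * P) := by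
          calc (P⁻¹ * f z * P) * c = P⁻¹ * (f z * (P * c * P⁻¹)) * P := by group
            _ = c * (P⁻¹ * f z * P) := by rw [h1]; group
        rw [← map_mul, h2, map_mul]
      have habel : ∀ {G : Type} [Group G] (τ : G →* PSL2C),
          (∀ (g h : G) (a b : SL2C), projPSL a = τ g → projPSL b = τ h →
            mx (P * a * P⁻¹) * mx (P * b * P⁻¹) = mx (P * b * P⁻¹) * mx (P * a * P⁻¹)) →
          ∀ g h : G, Commute (τ g) (τ h) := by
        intro G _ τ hh g h
        obtain ⟨a, ha⟩ := proj_surj (τ g)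
        obtain ⟨b, hb⟩ := proj_surj (τ h)
        have h1 := hh g h a b ha hb
        rw [← map_mul, ← map_mul] at h1
        have h2 := mx_inj h1
        have h3 : a * b = b * a := by
          calc a * b = P⁻¹ * (P * a * P⁻¹ * (P * b * P⁻¹)) * P := by group
            _ = b * a := by rw [h2]; group
        rw [← ha, ← hb, commute_iff_eq, ← map_mul, ← map_mul, h3]
      have hall : ∀ (v : Fin 2 → ℂ) (hv : v ≠ 0),
          (∀ g (a : SL2C), projPSL a = ρ (i₁ g) → projPSL a ∈ LFix v hv) →
          (∀ g (a : SL2C), projPSL a = ρ (i₂ g) → projPSL a ∈ LFix v hv) →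
          IsReducibleRep ρ := by
        intro v hv h1 h2
        rw [isRed_iff]
        refine ⟨v, hv, hgen ((LFix v hv).comap ρ) (fun g => ?_) (fun g => ?_)⟩
        · obtain ⟨a, ha⟩ := proj_surj (ρ (i₁ g))
          rw [Subgroup.mem_comap, ← ha]; exact h1 g a ha
        · obtain ⟨a, ha⟩ := proj_surj (ρ (i₂ g))
          rw [Subgroup.mem_comap, ← ha]; exact h2 g a ha
      have hone : ∀ {G : Type} [Group G] (τ : G →* PSL2C),
          (∀ (g : G) (a : SL2C), projPSL a = τ g → mx (P * a * P⁻¹) 1 0 = 0) →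
          IsReducibleRep τ := by
        intro G _ τ hh
        rw [isRed_iff]
        refine ⟨_, vec_ne P (![1, 0]) (by simp), fun g => ?_⟩
        obtain ⟨a, ha⟩ := proj_surj (τ g)
        rw [← ha]; exact up_fix _ _ (hh g a ha)
      rcases hP with ⟨hP01, hPne⟩ | ⟨hP01, hPeq⟩
      · -- torus case
        have hD := hmem Dz continuous_Dz Dz_zero (fun z => by
          rw [mx_Dz]
          ext i j; fin_cases i <;> fin_cases j <;> simp [mul_apply, Fin.sum_univ_two, -map_mul, hP01, hP10, mul_comm])
        have key : ∀ (g : Γ₁) (h : Γ₂) (a b : SL2C), projPSL a = ρ (i₁ g) → projPSL b = ρ (i₂ h) →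
            mx (P * a * P⁻¹) 0 1 * mx (P * b * P⁻¹) 1 0 = 0 ∧
            mx (P * a * P⁻¹) 1 0 * mx (P * b * P⁻¹) 0 1 = 0 :=
          fun g h a b ha hb => core_D _ _ fun z => HP P (Dz z) (hD z) g h a b ha hb
        have k1 : (∀ (g : Γ₁) (a : SL2C), projPSL a = ρ (i₁ g) → mx (P * a * P⁻¹) 0 1 = 0) ∨
            (∀ (g : Γ₂) (a : SL2C), projPSL a = ρ (i₂ g) → mx (P * a * P⁻¹) 1 0 = 0) := by
          by_contra! hcon
          obtain ⟨⟨g, a, ha, ha'⟩, ⟨h, b, hb, hb'⟩⟩ := hcon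
          exact mul_ne_zero ha' hb' (key g h a b ha hb).1
        have k2 : (∀ (g : Γ₁) (a : SL2C), projPSL a = ρ (i₁ g) → mx (P * a * P⁻¹) 1 0 = 0) ∨
            (∀ (g : Γ₂) (a : SL2C), projPSL a = ρ (i₂ g) → mx (P * a * P⁻¹) 0 1 = 0) := by
          by_contra! hcon
          obtain ⟨⟨g, a, ha, ha'⟩, ⟨h, b, hb, hb'⟩⟩ := hcon
          exact mul_ne_zero ha' hb' (key g h a b ha hb).2
        rcases k1 with k1 | k1 <;> rcases k2 with k2 | k2
        · left
          exact ⟨habel (ρ.comp i₁) fun g h a b ha hb => diag_comm (k1 g a ha) (k2 g a ha)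
            (k1 h b hb) (k2 h b hb), hone _ k2⟩
        · right; right
          exact hall _ (vec_ne P (![0, 1]) (by simp)) (fun g a ha => low_fix _ _ (k1 g a ha))
            (fun g a ha => low_fix _ _ (k2 g a ha))
        · right; right
          exact hall _ (vec_ne P (![1, 0]) (by simp)) (fun g a ha => up_fix _ _ (k2 g a ha))
            (fun g a ha => up_fix _ _ (k1 g a ha))
        · right; left
          exact ⟨habel (ρ.comp i₂) fun g h a b ha hb => diag_comm (k2 g a ha) (k1 g a ha)
            (k2 h b hb) (k1 h b hb), hone _ k1⟩
      · -- parabolic case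
        have hU := hmem Uz continuous_Uz Uz_zero (fun z =>
          unip_comm rfl rfl hP10 hPeq)
        have key : ∀ (g : Γ₁) (h : Γ₂) (a b : SL2C), projPSL a = ρ (i₁ g) → projPSL b = ρ (i₂ h) →
            mx (P * a * P⁻¹) 1 0 * mx (P * b * P⁻¹) 1 0 = 0 ∧
            (mx (P * a * P⁻¹) 0 0 - mx (P * a * P⁻¹) 1 1) * mx (P * b * P⁻¹) 1 0
              + mx (P * a * P⁻¹) 1 0 * (mx (P * b * P⁻¹) 1 1 - mx (P * b * P⁻¹) 0 0) = 0 :=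
          fun g h a b ha hb => core_U _ _ fun z => HP P (Uz z) (hU z) g h a b ha hb
        by_cases kA : ∀ (g : Γ₁) (a : SL2C), projPSL a = ρ (i₁ g) → mx (P * a * P⁻¹) 1 0 = 0
        · by_cases kB : ∀ (g : Γ₂) (a : SL2C), projPSL a = ρ (i₂ g) → mx (P * a * P⁻¹) 1 0 = 0
          · right; right
            exact hall _ (vec_ne P (![1, 0]) (by simp)) (fun g a ha => up_fix _ _ (kA g a ha))
              (fun g a ha => up_fix _ _ (kB g a ha))
          · left
            push Not at kB
            obtain ⟨h, b, hb, hb'⟩ := kB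
            have kE : ∀ (g : Γ₁) (a : SL2C), projPSL a = ρ (i₁ g) →
                mx (P * a * P⁻¹) 0 0 = mx (P * a * P⁻¹) 1 1 := by
              intro g a ha
              have := (key g h a b ha hb).2
              rw [kA g a ha, zero_mul, add_zero] at this
              exact sub_eq_zero.1 ((mul_eq_zero.1 this).resolve_right hb')
            exact ⟨habel (ρ.comp i₁) fun g h a b ha hb => unip_comm (kA g a ha) (kE g a ha)
              (kA h b hb) (kE h b hb), hone _ kA⟩
        · right; left
          push Not at kA
          obtain ⟨h, b, hb, hb'⟩ := kA
          have kB : ∀ (g : Γ₂) (a : SL2C), projPSL a = ρ (i₂ g) → mx (P * a * P⁻¹) 1 0 = 0 :=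
            fun g a ha => (mul_eq_zero.1 (key h g b a hb ha).1).resolve_left hb'
          have kE : ∀ (g : Γ₂) (a : SL2C), projPSL a = ρ (i₂ g) →
              mx (P * a * P⁻¹) 0 0 = mx (P * a * P⁻¹) 1 1 := by
            intro g a ha
            have := (key h g b a hb ha).2
            rw [kB g a ha, mul_zero, zero_add] at this
            exact (sub_eq_zero.1 ((mul_eq_zero.1 this).resolve_left hb')).symm
          exact ⟨habel (ρ.comp i₂) fun g h a b ha hb => unip_comm (kB g a ha) (kE g a ha)
            (kB h b hb) (kE h b hb), hone _ kB⟩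
  · intro hcase S hS ρS ⟨h1, h2⟩ γ
    -- commuting with one side is enough
    have hA : (∀ g : Γ₁, Commute S (ρ (i₁ g))) → tr2 (ρS γ) = tr2 (ρ γ) := by
      intro hcm
      have : ρS γ = S * ρ γ * S⁻¹ := by
        refine hgen (ρS.eqLocus ((MulAut.conj S).toMonoidHom.comp ρ)) (fun g => ?_)
          (fun g => ?_) γ
        · change ρS (i₁ g) = S * ρ (i₁ g) * S⁻¹
          rw [h1, hcm g, mul_inv_cancel_right]
        · exact h2 g
      rw [this, tr2_conj]
    have hB : (∀ g : Γ₂, Commute S (ρ (i₂ g))) → tr2 (ρS γ) = tr2 (ρ γ) := by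
      intro hcm
      have : ρS γ = ρ γ := by
        refine hgen (ρS.eqLocus ρ) (fun g => ?_) (fun g => ?_) γ
        · exact h1 g
        · change ρS (i₂ g) = ρ (i₂ g)
          rw [h2, hcm g, mul_inv_cancel_right]
      rw [this]
    rcases hcase with ⟨-, ht⟩ | ⟨hnt, ht⟩
    · rcases ht with ht | ht
      · exact hA fun g => by rw [ht g]; exact Commute.one_right _
      · exact hB fun g => by rw [ht g]; exact Commute.one_right _
    · push Not at hnt
      obtain ⟨g₀, hg₀⟩ := hnt
      obtain ⟨c, hc⟩ := proj_surj (ρ (i₁ (j₁ g₀)))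
      have hcN : NS (mx c) := by
        by_contra hN; rw [← proj_eq_one, hc] at hN; exact hg₀ hN
      obtain ⟨s, rfl⟩ := proj_surj S
      have hsc : mx s * mx c = mx c * mx s := comp_comm (by rw [hc]; exact hE g₀) hS
      have hred : ∀ {G : Type} [Group G] (τ : G →* PSL2C) (x : G), projPSL c = τ x →
          (∀ g h : G, Commute (τ g) (τ h)) → IsReducibleRep τ →
          ∀ g, Commute (projPSL s) (τ g) := by
        rintro G _ τ x hx hcm ⟨v, hv, hvv⟩ g
        obtain ⟨a, ha⟩ := proj_surj (τ g)
        obtain ⟨α, hα⟩ := hvv g a ha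
        obtain ⟨l, hl⟩ := hvv x c hx
        rw [← ha, comm_proj]
        left
        have hα : mx a *ᵥ v = α • v := hα
        have hl : mx c *ᵥ v = l • v := hl
        have hac : mx a * mx c = mx c * mx a := by
          have := hcm g x
          rw [← ha, ← hx, comm_proj] at this
          rcases this with h | h
          · exact h
          · exfalso
            have e1 : (mx a * mx c) *ᵥ v = (l * α) • v := by
              rw [← mulVec_mulVec, hl, mulVec_smul, hα, smul_smul]
            have e2 : (mx a * mx c) *ᵥ v = -((l * α) • v) := by
              rw [h, neg_mulVec, ← mulVec_mulVec, hα, mulVec_smul, hl, smul_smul, mul_comm]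
            rw [e1] at e2
            have e3 := self_eq_neg.1 e2
            rcases smul_eq_zero.1 e3 with e | e
            · exact mul_ne_zero (eig_inv c hv hl).1 (eig_inv a hv hα).1 e
            · exact hv e
        exact comm_of_comm hcN hac hsc
      rcases ht with ⟨hcm, hr⟩ | ⟨hcm, hr⟩ | ⟨v, hv, hvv⟩
      · exact hA (hred (ρ.comp i₁) (j₁ g₀) hc hcm hr)
      · exact hB (hred (ρ.comp i₂) (j₂ g₀) (by rw [hc, hsq]; rfl) hcm hr)
      · obtain ⟨l, hl⟩ := hvv _ c hc
        obtain ⟨m, hm⟩ := eig_of_comm hcN hsc hl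
        obtain ⟨M, N, l, hM, hN, hMv, hNv⟩ := hgen (pairSub v hv ρ ρS) (fun g => by
            obtain ⟨a, ha⟩ := proj_surj (ρ (i₁ g))
            obtain ⟨α, hα⟩ := hvv _ a ha
            exact ⟨a, a, α, ha, by rw [h1, ha], hα, hα⟩) (fun g => by
            obtain ⟨a, ha⟩ := proj_surj (ρ (i₂ g))
            obtain ⟨α, hα⟩ := hvv _ a ha
            have hα : mx a *ᵥ v = α • v := hα
            refine ⟨a, s * a * s⁻¹, α, ha, by rw [h2, map_mul, map_mul, map_inv, ha], hα, ?_⟩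
            have hm' := eig_inv s hv hm
            rw [map_mul, map_mul, ← mulVec_mulVec, hm'.2, mulVec_smul, ← mulVec_mulVec, hα,
              mulVec_smul, hm, smul_smul, smul_smul]
            congr 1
            have := hm'.1
            field_simp) γ
        rw [← hM, ← hN, tr2_proj, tr2_proj, trace_of_eig M hv hMv, trace_of_eig N hv hNv]
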